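/- Let A and B be unitary operators on ℂ^d ⊗ ℂ^D with A^d = 1 and B^d = 1 (so all their eigenvalues are d-th roots of unity) which satisfy the relations (i) Abar^{(k)} · Abar^{(d−k)} = 1 and (ii) Abar^{(k)} = (Abar^{(1)})^k for all k = 1,…,d−1. Then there exists a unitary V on ℂ^d ⊗ ℂ^D such that V A V† = Z_d ⊗ 1_D and V B V† = T_{d,m} ⊗ 1_D. -/

import Mathlib

open Matrix Kronecker

/-- `omg d t` is ω^t = exp(2πi·t/d), where ω = exp(2πi/d). -/
noncomputable def omg (d : ℕ) (t : ℝ) : ℂ :=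
  Complex.exp ((2 * Real.pi * t / d : ℝ) * Complex.I)

/-- The coefficient a_k = ω^{(2k−d)/(4m)} / (2 cos(π/(2m))). -/
noncomputable def acoef (d m k : ℕ) : ℂ :=
  omg d ((2 * (k : ℝ) - d) / (4 * m)) / ((2 * Real.cos (Real.pi / (2 * m)) : ℝ) : ℂ)

/-- `abar d m A B k` is Ābar^{(k)} = a_k A^k + conj(a_k) B^k. -/
noncomputable def abar {n : Type*} [Fintype n] [DecidableEq n] (d m : ℕ)
    (A B : Matrix n n ℂ) (k : ℕ) : Matrix n n ℂ :=
  acoef d m k • A ^ k + (starRingEnd ℂ) (acoef d m k) • B ^ k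

/-- Z_d = diag(1, ω, …, ω^{d−1}). -/
noncomputable def Zmat (d : ℕ) : Matrix (Fin d) (Fin d) ℂ :=
  Matrix.diagonal fun i => omg d (i : ℝ)

/-- T_{d,m} = Σ_i ω^{i+1/m}|i⟩⟨i| − (2i/d) sin(π/m) Σ_{i,j} (−1)^{δ_{i0}+δ_{j0}}
ω^{(i+j)/2−(d−2)/(2m)} |i⟩⟨j|. -/
noncomputable def Tmat (d m : ℕ) : Matrix (Fin d) (Fin d) ℂ :=
  Matrix.of fun i j =>
    (if i = j then omg d ((i : ℝ) + 1 / m) else 0) -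
      (2 * Complex.I / d) * (Real.sin (Real.pi / m) : ℂ) *
        ((-1 : ℂ) ^ (((if (i : ℕ) = 0 then 1 else 0) + (if (j : ℕ) = 0 then 1 else 0)) : ℕ)) *
        omg d (((i : ℝ) + j) / 2 - ((d : ℝ) - 2) / (2 * m))


section Algebra

variable {R : Type*} [Ring R] {X Y : R} {d : ℕ}

/-- If the powers of `α X + β Y` are the same combinations of the powers of `X` and `Y`,
then `X - Y` cannot tell the powers of `X` from those of `Y`. -/
theorem sub_mul_pow_eq_of_pow_affine [Algebra ℂ R] {α β : ℂ} (hαβ : α + β = 1)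
    (hα : α ≠ 0) (hβ : β ≠ 0)
    (h : ∀ k ≤ d, α • X ^ k + β • Y ^ k = (α • X + β • Y) ^ k) {k : ℕ} (hk : k < d) :
    (X - Y) * X ^ k = (X - Y) * Y ^ k := by
  have h1 := h (k + 1) hk
  rw [pow_succ' (α • X + β • Y), ← h k hk.le, pow_succ' X, pow_succ' Y] at h1
  obtain rfl : β = 1 - α := by rw [← hαβ]; ring
  have h2 : (α * (1 - α)) • ((X - Y) * X ^ k - (X - Y) * Y ^ k) = 0 := by
    rw [← sub_eq_zero] at h1
    rw [← h1]
    simp only [mul_add, add_mul, sub_mul, smul_mul_assoc, mul_smul_comm]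
    module
  exact sub_eq_zero.mp ((smul_eq_zero.mp h2).resolve_left (mul_ne_zero hα hβ))

theorem sub_mul_pow_mul_sub_eq_zero (h : ∀ k < d, (X - Y) * X ^ k = (X - Y) * Y ^ k)
    {k : ℕ} (hk : k + 1 < d) : (X - Y) * X ^ k * (X - Y) = 0 := by
  rw [mul_sub ((X - Y) * X ^ k), mul_assoc, ← pow_succ, h k (by omega), mul_assoc, ← pow_succ,
    h _ hk, sub_self]

theorem sub_mul_pow_pred_mul_sub (hd : 0 < d) (h : ∀ k < d, (X - Y) * X ^ k = (X - Y) * Y ^ k) :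
    (X - Y) * X ^ (d - 1) * (X - Y) = (X - Y) * (X ^ d - Y ^ d) := by
  rw [mul_sub ((X - Y) * X ^ (d - 1)), mul_assoc, ← pow_succ, h (d - 1) (by omega), mul_assoc,
    ← pow_succ, Nat.sub_add_cancel hd, mul_sub (X - Y)]

end Algebra

section Matrices

variable {n : Type*} [Fintype n] [DecidableEq n]

theorem trace_pow_sub_pow {X Y : Matrix n n ℂ} {d : ℕ}
    (h : ∀ k < d, (X - Y) * X ^ k = (X - Y) * Y ^ k) :
    (X ^ d - Y ^ d).trace = d * ((X - Y) * X ^ (d - 1)).trace := by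
  have key : ∀ k ≤ d, (X ^ k * Y ^ (d - k)).trace
      = (Y ^ d).trace + k * ((X - Y) * X ^ (d - 1)).trace := by
    intro k
    induction k with
    | zero => simp
    | succ k ih =>
      intro hk
      have h1 : X ^ (k + 1) * Y ^ (d - (k + 1))
          = X ^ k * Y ^ (d - k) + X ^ k * ((X - Y) * X ^ (d - (k + 1))) := by
        rw [h _ (by omega), show d - k = d - (k + 1) + 1 by omega, pow_succ' Y, pow_succ X]
        noncomm_ring
      rw [h1, trace_add, ih (by omega), trace_mul_comm (X ^ k), mul_assoc, ← pow_add,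
        show d - (k + 1) + k = d - 1 by omega]
      push_cast
      ring
  have := key d le_rfl
  simp only [Nat.sub_self, pow_zero, mul_one] at this
  rw [trace_sub, this]
  ring

/-- An idempotent `E` for which `1 - (1 - v) E` is unitary, with `v ≠ 1` a phase, is Hermitian. -/
theorem conjTranspose_eq_of_unitary_reflection {E : Matrix n n ℂ} {v : ℂ}
    (hv : v * star v = 1) (hv1 : v ≠ 1) (hE : E * E = E)
    (hS : (1 - (1 - v) • E) * (1 - (1 - v) • E)ᴴ = 1) : Eᴴ = E := by
  have h1 : E = v • E - (v - 1) • (E * Eᴴ) := by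
    calc E = E * ((1 - (1 - v) • E) * (1 - (1 - v) • E)ᴴ) := by rw [hS, mul_one]
      _ = (v • E) * (1 - (1 - v) • E)ᴴ := by
        rw [← mul_assoc]
        congr 1
        rw [mul_sub, mul_smul_comm, hE, mul_one]
        module
      _ = v • E - (v - v * star v) • (E * Eᴴ) := by
        simp only [conjTranspose_sub, conjTranspose_one, conjTranspose_smul, mul_sub, mul_one,
          smul_mul_assoc, mul_smul_comm, star_sub, star_one]
        module
      _ = _ := by rw [hv]
  have h2 : (v - 1) • (E - E * Eᴴ) = 0 := by
    have h3 : v • E - (v - 1) • (E * Eᴴ) - E = 0 := by rw [← h1, sub_self]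
    rw [← h3]
    module
  have h4 : E = E * Eᴴ :=
    sub_eq_zero.mp ((smul_eq_zero.mp h2).resolve_left (sub_ne_zero.mpr hv1))
  rw [h4, conjTranspose_mul, conjTranspose_conjTranspose]

/-- An orthogonal projection of trace `D` is `W Wᴴ` for an isometry `W` on `ℂ^D`. -/
theorem exists_isometry_of_projection {E : Matrix n n ℂ} {D : ℕ} (hH : Eᴴ = E) (hE : E * E = E)
    (htr : E.trace = D) : ∃ W : Matrix n (Fin D) ℂ, Wᴴ * W = 1 ∧ W * Wᴴ = E := by
  have hherm : E.IsHermitian := hH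
  set U : Matrix n n ℂ := hherm.eigenvectorUnitary.val
  set ev := hherm.eigenvalues
  have hU1 : Uᴴ * U = 1 := Unitary.coe_star_mul_self hherm.eigenvectorUnitary
  have hU2 : U * Uᴴ = 1 := Unitary.coe_mul_star_self hherm.eigenvectorUnitary
  have hspec : E = U * diagonal (fun i => (ev i : ℂ)) * Uᴴ := by
    have := hherm.spectral_theorem
    rw [Unitary.conjStarAlgAut_apply] at this
    exact this
  have hdiag : diagonal (fun i => (ev i : ℂ)) = Uᴴ * E * U := by
    rw [hspec]
    simp only [mul_assoc, hU1, mul_one]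
    rw [← mul_assoc, hU1, one_mul]
  have hev : ∀ i, ev i = 0 ∨ ev i = 1 := by
    have h1 : diagonal (fun i => (ev i : ℂ)) * diagonal (fun i => (ev i : ℂ))
        = diagonal (fun i => (ev i : ℂ)) := by
      rw [hdiag]
      calc Uᴴ * E * U * (Uᴴ * E * U) = Uᴴ * E * (U * Uᴴ) * E * U := by simp only [mul_assoc]
        _ = Uᴴ * (E * E) * U := by rw [hU2]; simp only [mul_assoc, mul_one]
        _ = _ := by rw [hE]
    intro i
    rw [diagonal_mul_diagonal] at h1
    have h2 : ev i * ev i = ev i := by exact_mod_cast congr_fun (diagonal_injective h1) i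
    rcases mul_eq_zero.mp (show ev i * (ev i - 1) = 0 by linear_combination h2) with h | h
    · exact Or.inl h
    · exact Or.inr (by linarith)
  have hcard : Fintype.card {i // ev i = 1} = D := by
    have h1 : ∑ i, (ev i : ℂ) = D := by rw [← htr, hherm.trace_eq_sum_eigenvalues]; rfl
    have h2 : ∀ i, (ev i : ℂ) = if ev i = 1 then 1 else 0 := by
      intro i
      rcases hev i with h | h <;> simp [h]
    simp_rw [h2] at h1
    rw [Finset.sum_boole] at h1
    rw [Fintype.card_subtype]
    exact_mod_cast h1
  let f := (Fintype.equivFinOfCardEq hcard).symm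
  refine ⟨of fun x r => U x (f r), ?_, ?_⟩
  · ext r s
    have := congr_fun (congr_fun hU1 (f r)) (f s)
    simp only [mul_apply, conjTranspose_apply, one_apply] at this
    simp only [mul_apply, conjTranspose_apply, one_apply, of_apply, this, Subtype.val_inj,
      EmbeddingLike.apply_eq_iff_eq]
  · ext x y
    have hsum : ∑ r, U x (f r) * star (U y (f r)) = ∑ i : {i // ev i = 1}, U x i * star (U y i) :=
      Equiv.sum_comp f fun i : {i // ev i = 1} => U x i * star (U y i)
    rw [hspec, mul_apply, mul_apply]
    simp only [mul_diagonal, conjTranspose_apply, of_apply]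
    rw [hsum, ← Finset.sum_subtype (Finset.univ.filter fun i => ev i = 1) (by simp)
      (fun i => U x i * star (U y i)), Finset.sum_filter]
    refine Finset.sum_congr rfl fun i _ => ?_
    rcases hev i with h | h <;> simp [h]

end Matrices

section Fourier

variable {n : Type*} [Fintype n] [DecidableEq n]

/-- The average of `ζ^{-ij} A^j`: the spectral projection of `A` for the eigenvalue `ζ^i`. -/
noncomputable def rootProj (d : ℕ) (ζ : ℂ) (A : Matrix n n ℂ) (i : ℕ) : Matrix n n ℂ :=
  (d : ℂ)⁻¹ • ∑ j ∈ Finset.range d, (star ζ ^ (i * j)) • A ^ j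

variable {d : ℕ} {ζ : ℂ} {A : Matrix n n ℂ}

theorem star_pow_mul_pow (h1 : ζ * star ζ = 1) (k : ℕ) : star ζ ^ k * ζ ^ k = 1 := by
  rw [← mul_pow, mul_comm, h1, one_pow]

theorem mul_rootProj (hζ : ζ ^ d = 1) (h1 : ζ * star ζ = 1) (hA : A ^ d = 1) (i : ℕ) :
    A * rootProj d ζ A i = ζ ^ i • rootProj d ζ A i := by
  have hs : star ζ ^ d = 1 := by rw [← star_pow, hζ, star_one]
  have hshift : ∑ j ∈ Finset.range d, star ζ ^ (i * (j + 1)) • A ^ (j + 1)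
      = ∑ j ∈ Finset.range d, star ζ ^ (i * j) • A ^ j := by
    have h2 := Finset.sum_range_succ (fun j => star ζ ^ (i * j) • A ^ j) d
    rw [Finset.sum_range_succ'] at h2
    rw [hA, pow_mul' (star ζ) i d, hs] at h2
    simpa using h2
  rw [rootProj, mul_smul_comm, smul_comm]
  congr 1
  conv_rhs => rw [← hshift]
  rw [Finset.mul_sum, Finset.smul_sum]
  refine Finset.sum_congr rfl fun j _ => ?_
  rw [mul_smul_comm, smul_smul, ← pow_succ', mul_add, mul_one, pow_add]
  congr 1
  linear_combination (-(star ζ ^ (i * j))) * star_pow_mul_pow h1 i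

theorem sum_pow_mul_star_pow (hζ : IsPrimitiveRoot ζ d) (h1 : ζ * star ζ = 1) (i k : Fin d) :
    ∑ j ∈ Finset.range d, ζ ^ ((i : ℕ) * j) * star ζ ^ ((k : ℕ) * j)
      = if i = k then (d : ℂ) else 0 := by
  simp_rw [pow_mul, ← mul_pow]
  split_ifs with h
  · subst h
    simp only [← mul_pow, h1, one_pow, Finset.sum_const, Finset.card_range, nsmul_one]
  · set x := ζ ^ (i : ℕ) * star ζ ^ (k : ℕ) with hx
    have hx1 : x ≠ 1 := by
      intro h2
      apply h
      have h3 : ζ ^ (i : ℕ) = ζ ^ (k : ℕ) := by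
        linear_combination (-(ζ ^ (i : ℕ))) * star_pow_mul_pow h1 k
          + ζ ^ (k : ℕ) * (hx.symm.trans h2)
      exact Fin.ext (hζ.pow_inj i.2 k.2 h3)
    have hxd : x ^ d = 1 := by
      rw [hx, mul_pow, ← pow_mul, ← pow_mul, mul_comm _ d, mul_comm _ d, pow_mul, pow_mul,
        ← star_pow ζ d, hζ.pow_eq_one]
      simp
    have h4 := mul_geom_sum x d
    rw [hxd, sub_self] at h4
    exact (mul_eq_zero.mp h4).resolve_left (sub_ne_zero.mpr hx1)

theorem conjTranspose_rootProj_mul (hd : d ≠ 0) (hζ : IsPrimitiveRoot ζ d) (h1 : ζ * star ζ = 1)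
    (hA : A ^ d = 1) (hU : Aᴴ * A = 1) (i k : Fin d) :
    (rootProj d ζ A i)ᴴ * rootProj d ζ A k = if i = k then rootProj d ζ A k else 0 := by
  have hmul := mul_rootProj hζ.pow_eq_one h1 hA (k : ℕ)
  have hinv : Aᴴ * rootProj d ζ A k = star ζ ^ (k : ℕ) • rootProj d ζ A k := by
    have h2 := congr_arg (fun M => star ζ ^ (k : ℕ) • (Aᴴ * M)) hmul
    simp only [mul_smul_comm, smul_smul, star_pow_mul_pow h1, one_smul] at h2
    rw [← h2, ← mul_assoc, hU, one_mul]
  have hpow : ∀ j, Aᴴ ^ j * rootProj d ζ A k = star ζ ^ ((k : ℕ) * j) • rootProj d ζ A k := by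
    intro j
    induction j with
    | zero => simp
    | succ j ih =>
      rw [pow_succ, mul_assoc, hinv, mul_smul_comm, ih, smul_smul, ← pow_add]
      congr 2
      ring
  have hstar : (rootProj d ζ A i)ᴴ
      = (d : ℂ)⁻¹ • ∑ j ∈ Finset.range d, ζ ^ ((i : ℕ) * j) • Aᴴ ^ j := by
    simp [rootProj, conjTranspose_sum, conjTranspose_smul, conjTranspose_pow]
  rw [hstar, smul_mul_assoc, Finset.sum_mul]
  simp_rw [smul_mul_assoc, hpow, smul_smul]
  rw [← Finset.sum_smul, sum_pow_mul_star_pow hζ h1]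
  split_ifs
  · rw [smul_smul, inv_mul_cancel₀ (by exact_mod_cast hd), one_smul]
  · simp

theorem sum_rootProj (hd : d ≠ 0) (hζ : IsPrimitiveRoot ζ d) (h1 : ζ * star ζ = 1) :
    ∑ i : Fin d, rootProj d ζ A i = 1 := by
  simp only [rootProj]
  rw [← Finset.smul_sum, Finset.sum_comm]
  have h2 : ∀ j ∈ Finset.range d, ∑ i : Fin d, star ζ ^ ((i : ℕ) * j) • A ^ j
      = if j = 0 then (d : ℂ) • (1 : Matrix n n ℂ) else 0 := by
    intro j hj
    rw [← Finset.sum_smul]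
    have h3 := sum_pow_mul_star_pow hζ h1 ⟨0, by omega⟩ ⟨j, Finset.mem_range.mp hj⟩
    simp only [zero_mul, pow_zero, one_mul, Fin.mk.injEq] at h3
    rw [Fin.sum_univ_eq_sum_range (fun i => star ζ ^ (i * j)) d]
    simp_rw [mul_comm _ j, h3]
    by_cases hj0 : j = 0
    · simp [hj0]
    · simp [hj0, Ne.symm hj0]
  rw [Finset.sum_congr rfl h2, Finset.sum_ite_eq' (Finset.range d) 0]
  rw [if_pos (Finset.mem_range.mpr (Nat.pos_of_ne_zero hd)), smul_smul,
    inv_mul_cancel₀ (by exact_mod_cast hd), one_smul]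

theorem conjTranspose_mul_rootProj_mul {D : ℕ} {W : Matrix n (Fin D) ℂ} (hd : d ≠ 0)
    (hW : Wᴴ * W = 1) (hWA : ∀ j, 1 ≤ j → j < d → Wᴴ * A ^ j * W = 0) (i : ℕ) :
    Wᴴ * rootProj d ζ A i * W = (d : ℂ)⁻¹ • (1 : Matrix (Fin D) (Fin D) ℂ) := by
  rw [rootProj, Matrix.mul_smul, Matrix.smul_mul, Matrix.mul_sum, Matrix.sum_mul,
    Finset.sum_eq_single_of_mem 0 (Finset.mem_range.mpr (Nat.pos_of_ne_zero hd))]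
  · simp [hW]
  · intro j hj hj0
    rw [Matrix.mul_smul, Matrix.smul_mul, hWA j (by omega) (Finset.mem_range.mp hj), smul_zero]

/-- A unitary of order `d` with a wandering isometry `W` is `diag(ζ^i) ⊗ 1`, in coordinates where
`W Wᴴ` becomes the rank-one projection on a prescribed flat vector `e`, tensored with `1`. -/
theorem exists_unitary_of_wandering {D : ℕ} {W : Matrix (Fin d × Fin D) (Fin D) ℂ}
    {A B : Matrix (Fin d × Fin D) (Fin d × Fin D) ℂ} {p γ : ℂ} {e : Fin d → ℂ}
    {Z T : Matrix (Fin d) (Fin d) ℂ} (hd : d ≠ 0)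
    (hζ : IsPrimitiveRoot ζ d) (h1 : ζ * star ζ = 1) (hA : A ^ d = 1) (hU : Aᴴ * A = 1)
    (hW : Wᴴ * W = 1) (hWA : ∀ j, 1 ≤ j → j < d → Wᴴ * A ^ j * W = 0)
    (hB : B = p • ((1 - γ • (W * Wᴴ)) * A)) (he : ∀ i, e i * star (e i) = (d : ℂ)⁻¹)
    (hZ : Z = diagonal fun i : Fin d => ζ ^ (i : ℕ))
    (hT : ∀ i j, T i j
      = p * ((if i = j then ζ ^ (i : ℕ) else 0) - γ * (e i * star (e j) * ζ ^ (j : ℕ)))) :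
    ∃ V ∈ Matrix.unitaryGroup (Fin d × Fin D) ℂ,
      V * A * Vᴴ = Z ⊗ₖ (1 : Matrix (Fin D) (Fin D) ℂ) ∧
      V * B * Vᴴ = T ⊗ₖ (1 : Matrix (Fin D) (Fin D) ℂ) := by
  have hdC : (d : ℂ) ≠ 0 := Nat.cast_ne_zero.mpr hd
  have he0 : ∀ i, e i ≠ 0 := by
    intro i h
    have := he i
    rw [h, zero_mul] at this
    exact inv_ne_zero hdC this.symm
  let M : Fin d → Matrix (Fin d × Fin D) (Fin D) ℂ := fun i => (e i)⁻¹ • (rootProj d ζ A i * W)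
  let F : Matrix (Fin d × Fin D) (Fin d × Fin D) ℂ := of fun x c => M c.1 x c.2
  have hAM : ∀ i, A * M i = ζ ^ (i : ℕ) • M i := by
    intro i
    simp only [M]
    rw [Matrix.mul_smul, ← Matrix.mul_assoc, mul_rootProj hζ.pow_eq_one h1 hA,
      Matrix.smul_mul, smul_comm]
  have hWM : ∀ i, Wᴴ * M i = star (e i) • (1 : Matrix (Fin D) (Fin D) ℂ) := by
    intro i
    simp only [M]
    rw [Matrix.mul_smul, ← Matrix.mul_assoc, conjTranspose_mul_rootProj_mul hd hW hWA, smul_smul,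
      ← he i, inv_mul_cancel_left₀ (he0 i)]
  have hsum : W = ∑ i, e i • M i := by
    simp only [M, smul_smul, mul_inv_cancel₀ (he0 _), one_smul]
    rw [← Matrix.sum_mul, sum_rootProj hd hζ h1, Matrix.one_mul]
  have hMM : ∀ i k, (M i)ᴴ * M k = if i = k then (1 : Matrix (Fin D) (Fin D) ℂ) else 0 := by
    intro i k
    have h2 : (M i)ᴴ * M k = (star (e i)⁻¹ * (e k)⁻¹) •
        (Wᴴ * ((rootProj d ζ A i)ᴴ * rootProj d ζ A k) * W) := by
      simp only [M, conjTranspose_smul, conjTranspose_mul, Matrix.smul_mul, Matrix.mul_smul, smul_smul,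
        Matrix.mul_assoc, mul_comm (e k)⁻¹]
    rw [h2, conjTranspose_rootProj_mul hd hζ h1 hA hU]
    split_ifs with h
    · subst h
      rw [conjTranspose_mul_rootProj_mul hd hW hWA, smul_smul, ← he i, star_inv₀]
      have h3 : star (e i) ≠ 0 := star_ne_zero.mpr (he0 i)
      have h4 := he0 i
      rw [show (star (e i))⁻¹ * (e i)⁻¹ * (e i * star (e i)) = 1 by field_simp, one_smul]
    · simp
  have hBM : ∀ i, B * M i = ∑ k, T k i • M k := by
    intro i
    have h2 : B * M i = (p * ζ ^ (i : ℕ)) • M i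
        - (p * ζ ^ (i : ℕ) * γ * star (e i)) • ∑ k, e k • M k := by
      rw [← hsum, hB, Matrix.smul_mul, Matrix.mul_assoc, hAM, Matrix.mul_smul,
        Matrix.sub_mul, Matrix.one_mul, Matrix.smul_mul,
        Matrix.mul_assoc, hWM, Matrix.mul_smul, Matrix.mul_one]
      module
    rw [h2]
    have h3 : (p * ζ ^ (i : ℕ)) • M i = ∑ k, (if k = i then p * ζ ^ (k : ℕ) else 0) • M k := by
      simp [ite_smul]
    rw [h3, Finset.smul_sum, ← Finset.sum_sub_distrib]
    refine Finset.sum_congr rfl fun k _ => ?_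
    rw [smul_smul (_ * star (e i)) (e k) (M k), ← sub_smul, hT]
    congr 1
    split_ifs <;> ring
  have hmulF : ∀ S : Matrix (Fin d) (Fin d) ℂ, ∀ G : Matrix (Fin d × Fin D) (Fin d × Fin D) ℂ,
      (∀ i, G * M i = ∑ k, S k i • M k) →
      G * F = F * (S ⊗ₖ (1 : Matrix (Fin D) (Fin D) ℂ)) := by
    intro S G h
    ext x ⟨i, r⟩
    have h2 : (G * F) x (i, r) = (G * M i) x r := rfl
    rw [h2, h, Matrix.sum_apply, mul_apply, Fintype.sum_prod_type]
    refine Finset.sum_congr rfl fun k _ => ?_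
    simp [F, kroneckerMap_apply, one_apply, mul_comm]
  have hFF : Fᴴ * F = 1 := by
    ext ⟨i, r⟩ ⟨k, s⟩
    have h2 : (Fᴴ * F) (i, r) (k, s) = ((M i)ᴴ * M k) r s := rfl
    rw [h2, hMM]
    by_cases h : i = k <;> simp [h, one_apply]
  have hconj : ∀ S : Matrix (Fin d) (Fin d) ℂ, ∀ G : Matrix (Fin d × Fin D) (Fin d × Fin D) ℂ,
      (∀ i, G * M i = ∑ k, S k i • M k) →
      Fᴴ * G * Fᴴᴴ = S ⊗ₖ (1 : Matrix (Fin D) (Fin D) ℂ) := by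
    intro S G h
    rw [conjTranspose_conjTranspose, Matrix.mul_assoc, hmulF S G h, ← Matrix.mul_assoc,
      hFF, one_mul]
  refine ⟨Fᴴ, ?_, hconj Z A fun i => ?_, hconj T B hBM⟩
  · rw [mem_unitaryGroup_iff, star_eq_conjTranspose, conjTranspose_conjTranspose, hFF]
  · rw [hAM, hZ]
    simp [diagonal_apply, ite_smul]

end Fourier


section Projection

variable {n : Type*} [Fintype n] [DecidableEq n]

/-- Two unitaries `X`, `Y` whose `d`-th powers are conjugate phases `u ≠ ± 1`, and such that powers
commute with a fixed affine combination, differ by a reflection along a wandering projection. -/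
theorem exists_wandering_projection {X Y : Matrix n n ℂ} {α β u : ℂ} {d D : ℕ} (hd : d ≠ 0)
    (hαβ : α + β = 1) (hα : α ≠ 0) (hβ : β ≠ 0)
    (h : ∀ k ≤ d, α • X ^ k + β • Y ^ k = (α • X + β • Y) ^ k)
    (hu : u * star u = 1) (hu2 : u ^ 2 ≠ 1) (hXd : X ^ d = u • 1) (hYd : Y ^ d = star u • 1)
    (hX : X * Xᴴ = 1) (hY : Y * Yᴴ = 1) (hcard : Fintype.card n = d * D) :
    ∃ E : Matrix n n ℂ, Eᴴ = E ∧ E * E = E ∧ E.trace = D ∧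
      (∀ j, 1 ≤ j → j < d → E * X ^ j * E = 0) ∧ Y = (1 - (1 - star u ^ 2) • E) * X := by
  have hN : ∀ k < d, (X - Y) * X ^ k = (X - Y) * Y ^ k := fun k hk =>
    sub_mul_pow_eq_of_pow_affine hαβ hα hβ h hk
  have hdC : (d : ℂ) ≠ 0 := Nat.cast_ne_zero.mpr hd
  have hpos : 0 < d := Nat.pos_of_ne_zero hd
  set c : ℂ := u - star u with hc
  have hc0 : c ≠ 0 := by
    intro h0
    apply hu2
    rw [← hu]
    linear_combination u * (hc.symm.trans h0)
  have hdiff : X ^ d - Y ^ d = c • (1 : Matrix n n ℂ) := by rw [hXd, hYd, ← sub_smul]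
  set N := X - Y with hNdef
  set E : Matrix n n ℂ := c⁻¹ • (N * X ^ (d - 1)) with hE
  have hEN : E * N = N := by
    rw [hE, smul_mul_assoc, sub_mul_pow_pred_mul_sub hpos hN, hdiff, mul_smul_comm, mul_one,
      smul_smul, inv_mul_cancel₀ hc0, one_smul]
  have hEE : E * E = E := by
    nth_rewrite 2 [hE]
    rw [mul_smul_comm, ← mul_assoc, hEN]
  have hEX : (1 - star u ^ 2) • (E * X) = N := by
    rw [hE, smul_mul_assoc, mul_assoc, ← pow_succ, Nat.sub_add_cancel hpos, hXd, mul_smul_comm,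
      mul_one, smul_smul, smul_smul]
    rw [show (1 - star u ^ 2) * c⁻¹ * u = c⁻¹ * c by
      rw [hc]; linear_combination (-(u - star u)⁻¹ * star u) * hu, inv_mul_cancel₀ hc0, one_smul]
  have hYS : Y = (1 - (1 - star u ^ 2) • E) * X := by
    rw [sub_mul, one_mul, smul_mul_assoc, hEX, hNdef]
    abel
  have hS : (1 - (1 - star u ^ 2) • E) = Y * Xᴴ := by
    rw [hYS, mul_assoc, hX, mul_one]
  have hX' : Xᴴ * X = 1 := mul_eq_one_comm.mp hX
  have hv : star u ^ 2 * star (star u ^ 2) = 1 := by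
    rw [star_pow, star_star, ← mul_pow, mul_comm, hu, one_pow]
  have hv1 : star u ^ 2 ≠ 1 := by
    intro h1
    apply hu2
    have := congr_arg star h1
    rwa [star_pow, star_star, star_one] at this
  refine ⟨E, conjTranspose_eq_of_unitary_reflection hv hv1 hEE ?_, hEE, ?_, ?_, hYS⟩
  · rw [hS, conjTranspose_mul, conjTranspose_conjTranspose, mul_assoc, ← mul_assoc Xᴴ, hX',
      one_mul, hY]
  · have h1 := trace_pow_sub_pow hN
    rw [hdiff, trace_smul, trace_one, hcard, smul_eq_mul, Nat.cast_mul] at h1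
    rw [hE, trace_smul, smul_eq_mul, inv_mul_eq_iff_eq_mul₀ hc0]
    apply mul_left_cancel₀ hdC
    rw [← h1]
    ring
  · intro j hj hjd
    have h1 : X ^ (d - 1) * X ^ j = u • X ^ (j - 1) := by
      rw [← pow_add, show d - 1 + j = d + (j - 1) by omega, pow_add, hXd, smul_mul_assoc, one_mul]
    have h2 := sub_mul_pow_mul_sub_eq_zero hN (k := j - 1) (by omega)
    rw [hE, smul_mul_assoc, smul_mul_assoc, mul_smul_comm, mul_assoc N, h1, mul_smul_comm,
      smul_mul_assoc, ← mul_assoc, h2]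
    simp

end Projection

section Phases

variable {d : ℕ}

theorem omg_add (d : ℕ) (s t : ℝ) : omg d (s + t) = omg d s * omg d t := by
  rw [omg, omg, omg, ← Complex.exp_add]
  congr 1
  push_cast
  ring

theorem omg_zero (d : ℕ) : omg d 0 = 1 := by simp [omg]

theorem star_omg (d : ℕ) (t : ℝ) : star (omg d t) = omg d (-t) := by
  rw [omg, omg, ← starRingEnd_apply, ← Complex.exp_conj, map_mul, Complex.conj_I,
    Complex.conj_ofReal]
  congr 1
  push_cast
  ring

theorem omg_mul_star (d : ℕ) (t : ℝ) : omg d t * star (omg d t) = 1 := by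
  rw [star_omg, ← omg_add, add_neg_cancel, omg_zero]

theorem omg_pow (d : ℕ) (t : ℝ) (k : ℕ) : omg d t ^ k = omg d (k * t) := by
  rw [omg, omg, ← Complex.exp_nat_mul]
  congr 1
  push_cast
  ring

theorem isPrimitiveRoot_omg_one (hd : d ≠ 0) : IsPrimitiveRoot (omg d 1) d := by
  have h := Complex.isPrimitiveRoot_exp d hd
  rw [omg]
  convert h using 2
  push_cast
  ring

theorem omg_add_omg_neg (d : ℕ) (t : ℝ) :
    omg d t + omg d (-t) = ((2 * Real.cos (2 * Real.pi * t / d) : ℝ) : ℂ) := by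
  rw [omg, omg]
  push_cast
  rw [Complex.two_cos]
  ring_nf

theorem omg_sub_omg_neg (d : ℕ) (t : ℝ) :
    omg d t - omg d (-t) = 2 * Complex.I * (Real.sin (2 * Real.pi * t / d) : ℂ) := by
  rw [omg, omg]
  push_cast
  have h := Complex.two_sin (2 * Real.pi * t / d)
  rw [show (2 * Real.pi * -t / d : ℂ) * Complex.I = -(2 * Real.pi * t / d) * Complex.I by ring]
  linear_combination (-Complex.I) * h + (Complex.exp (2 * Real.pi * t / d * Complex.I)
    - Complex.exp (-(2 * Real.pi * t / d) * Complex.I)) * Complex.I_sq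

theorem omg_sq_ne_one {m : ℕ} (hd : d ≠ 0) (hm : 2 ≤ m) : omg d (d / (2 * m)) ^ 2 ≠ 1 := by
  have h := (Complex.isPrimitiveRoot_exp m (by omega)).ne_one (by omega)
  have hd' : (d : ℂ) ≠ 0 := Nat.cast_ne_zero.mpr hd
  have hm' : (m : ℂ) ≠ 0 := Nat.cast_ne_zero.mpr (by omega)
  convert h using 1
  rw [omg_pow, omg]
  congr 1
  push_cast
  field_simp

end Phases

section Coefficients

variable {d m : ℕ}

theorem two_cos_ne_zero (hm : 2 ≤ m) : ((2 * Real.cos (Real.pi / (2 * m)) : ℝ) : ℂ) ≠ 0 := by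
  have hm' : (2 : ℝ) ≤ m := by exact_mod_cast hm
  have hpi := Real.pi_pos
  have : 0 < Real.cos (Real.pi / (2 * m)) := by
    apply Real.cos_pos_of_mem_Ioo
    constructor
    · have : 0 < Real.pi / (2 * m) := by positivity
      linarith
    · apply div_lt_div_of_pos_left hpi (by norm_num)
      linarith
  exact_mod_cast (by positivity : (2 * Real.cos (Real.pi / (2 * m)) : ℝ) ≠ 0)

theorem acoef_ne_zero (d : ℕ) (hm : 2 ≤ m) (k : ℕ) : acoef d m k ≠ 0 :=
  div_ne_zero (Complex.exp_ne_zero _) (two_cos_ne_zero hm)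

theorem star_acoef (d m k : ℕ) : star (acoef d m k)
    = omg d (-((2 * (k : ℝ) - d) / (4 * m))) / ((2 * Real.cos (Real.pi / (2 * m)) : ℝ) : ℂ) := by
  rw [acoef, star_div₀, star_omg]
  congr 1
  exact Complex.conj_ofReal _

theorem acoef_eq_mul_pow (hm : 2 ≤ m) (k : ℕ) :
    acoef d m k = acoef d m 0 * omg d (1 / (2 * m)) ^ k := by
  have hm' : (m : ℝ) ≠ 0 := Nat.cast_ne_zero.mpr (by omega)
  rw [omg_pow, acoef, acoef, div_mul_eq_mul_div, ← omg_add]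
  congr 2
  field_simp
  push_cast
  ring

theorem acoef_zero_add_star (hd : d ≠ 0) (hm : 2 ≤ m) :
    acoef d m 0 + star (acoef d m 0) = 1 := by
  have hm' : (m : ℝ) ≠ 0 := Nat.cast_ne_zero.mpr (by omega)
  have hd' : (d : ℝ) ≠ 0 := Nat.cast_ne_zero.mpr hd
  rw [star_acoef, acoef, ← add_div, omg_add_omg_neg,
    show 2 * Real.pi * ((2 * ((0 : ℕ) : ℝ) - d) / (4 * m)) / d = -(Real.pi / (2 * m)) by
      push_cast; field_simp; ring,
    Real.cos_neg, div_self (two_cos_ne_zero hm)]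

theorem acoef_zero_mul_omg (hm : 2 ≤ m) :
    acoef d m 0 * omg d (d / (2 * m)) = star (acoef d m 0) := by
  have hm' : (m : ℝ) ≠ 0 := Nat.cast_ne_zero.mpr (by omega)
  rw [star_acoef, acoef, div_mul_eq_mul_div, ← omg_add]
  congr 2
  push_cast
  field_simp
  ring

theorem abar_eq {n : Type*} [Fintype n] [DecidableEq n] (hm : 2 ≤ m) (A B : Matrix n n ℂ) (k : ℕ) :
    abar d m A B k = acoef d m 0 • (omg d (1 / (2 * m)) • A) ^ k
      + star (acoef d m 0) • (star (omg d (1 / (2 * m))) • B) ^ k := by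
  rw [abar, starRingEnd_apply, acoef_eq_mul_pow hm, smul_pow, smul_pow, smul_smul, smul_smul,
    star_mul', star_pow]

/-- The flat vector along which `T_{d,m}` is a reflection of `ω^{1/m} Z_d`. -/
noncomputable def reflVec (d : ℕ) (i : Fin d) : ℂ :=
  ((√d : ℝ) : ℂ)⁻¹ * (-1) ^ (if (i : ℕ) = 0 then 1 else 0) * omg d ((i : ℝ) / 2)

theorem star_reflVec (i : Fin d) : star (reflVec d i)
    = ((√d : ℝ) : ℂ)⁻¹ * (-1) ^ (if (i : ℕ) = 0 then 1 else 0) * omg d (-((i : ℝ) / 2)) := by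
  rw [reflVec, star_mul', star_mul', star_pow, star_neg, star_one, star_omg, star_inv₀]
  congr 3
  exact Complex.conj_ofReal _

theorem inv_sqrt_mul_inv_sqrt (d : ℕ) : ((√d : ℝ) : ℂ)⁻¹ * ((√d : ℝ) : ℂ)⁻¹ = (d : ℂ)⁻¹ := by
  rw [← mul_inv, ← Complex.ofReal_mul, Real.mul_self_sqrt (Nat.cast_nonneg d),
    Complex.ofReal_natCast]

theorem reflVec_mul_star (i : Fin d) : reflVec d i * star (reflVec d i) = (d : ℂ)⁻¹ := by
  have h1 := omg_mul_star d ((i : ℝ) / 2)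
  have h2 : ((-1 : ℂ) ^ (if (i : ℕ) = 0 then 1 else 0)) ^ 2 = 1 := by split_ifs <;> norm_num
  rw [star_omg] at h1
  rw [star_reflVec, reflVec]
  calc _ = ((√d : ℝ) : ℂ)⁻¹ * ((√d : ℝ) : ℂ)⁻¹ * ((-1 : ℂ) ^ (if (i : ℕ) = 0 then 1 else 0)) ^ 2
        * (omg d ((i : ℝ) / 2) * omg d (-((i : ℝ) / 2))) := by ring
    _ = _ := by rw [h1, h2, inv_sqrt_mul_inv_sqrt, mul_one, mul_one]

theorem Tmat_apply (hd : d ≠ 0) (hm : 2 ≤ m) (i j : Fin d) :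
    Tmat d m i j = omg d (1 / (2 * m)) ^ 2 * ((if i = j then omg d 1 ^ (i : ℕ) else 0)
      - (1 - star (omg d (d / (2 * m))) ^ 2) *
        (reflVec d i * star (reflVec d j) * omg d 1 ^ (j : ℕ))) := by
  have hm' : (m : ℝ) ≠ 0 := Nat.cast_ne_zero.mpr (by omega)
  have hd' : (d : ℝ) ≠ 0 := Nat.cast_ne_zero.mpr hd
  have hsin := omg_sub_omg_neg d (d / (2 * m))
  rw [show 2 * Real.pi * (d / (2 * m)) / d = Real.pi / m by field_simp] at hsin
  have hu := omg_mul_star d (d / (2 * m))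
  rw [star_omg] at hu
  have hsplit : omg d (((i : ℝ) + j) / 2 - ((d : ℝ) - 2) / (2 * m))
      = omg d (1 / (2 * m)) ^ 2 * omg d (-(d / (2 * m))) * omg d ((i : ℝ) / 2)
        * omg d (-((j : ℝ) / 2)) * omg d 1 ^ (j : ℕ) := by
    rw [omg_pow, omg_pow, ← omg_add, ← omg_add, ← omg_add, ← omg_add]
    congr 1
    push_cast
    field_simp
    ring
  have hdiag : omg d ((i : ℝ) + 1 / m) = omg d (1 / (2 * m)) ^ 2 * omg d 1 ^ (i : ℕ) := by
    rw [omg_pow, omg_pow, ← omg_add]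
    congr 1
    push_cast
    field_simp
    ring
  rw [Tmat, of_apply, hsplit, hdiag, star_omg, star_reflVec, reflVec, pow_add]
  rw [show (2 * Complex.I / d) * (Real.sin (Real.pi / m) : ℂ)
      = (d : ℂ)⁻¹ * (2 * Complex.I * (Real.sin (Real.pi / m) : ℂ)) by ring, ← hsin,
    ← inv_sqrt_mul_inv_sqrt, show 1 - omg d (-(d / (2 * m))) ^ 2
      = omg d (-(d / (2 * m))) * (omg d (d / (2 * m)) - omg d (-(d / (2 * m)))) by
      linear_combination -hu]
  by_cases h : i = j
  · rw [if_pos h, if_pos h]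
    ring
  · rw [if_neg h, if_neg h]
    ring

end Coefficients

/-- Unitaries A, B on ℂ^d ⊗ ℂ^D with A^d = B^d = 1 satisfying the relations
(i) Ābar^{(k)} Ābar^{(d−k)} = 1 and (ii) Ābar^{(k)} = (Ābar^{(1)})^k are simultaneously
unitarily equivalent to Z_d ⊗ 1_D and T_{d,m} ⊗ 1_D. -/
theorem stmt13 (d m D : ℕ) (hd : 2 ≤ d) (hm : 2 ≤ m) (hD : 1 ≤ D)
    (A B : Matrix (Fin d × Fin D) (Fin d × Fin D) ℂ)
    (hA : A ∈ Matrix.unitaryGroup (Fin d × Fin D) ℂ)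
    (hB : B ∈ Matrix.unitaryGroup (Fin d × Fin D) ℂ)
    (hAd : A ^ d = 1) (hBd : B ^ d = 1)
    (hrel1 : ∀ k, 1 ≤ k → k ≤ d - 1 → abar d m A B k * abar d m A B (d - k) = 1)
    (hrel2 : ∀ k, 1 ≤ k → k ≤ d - 1 → abar d m A B k = (abar d m A B 1) ^ k) :
    ∃ V ∈ Matrix.unitaryGroup (Fin d × Fin D) ℂ,
      V * A * Vᴴ = Zmat d ⊗ₖ (1 : Matrix (Fin D) (Fin D) ℂ) ∧
      V * B * Vᴴ = Tmat d m ⊗ₖ (1 : Matrix (Fin D) (Fin D) ℂ) := by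
  have hd0 : d ≠ 0 := by omega
  have hA1 : A * Aᴴ = 1 := mem_unitaryGroup_iff.mp hA
  have hB1 : B * Bᴴ = 1 := mem_unitaryGroup_iff.mp hB
  set q := omg d (1 / (2 * m)) with hq
  set u := omg d (d / (2 * m)) with hu
  have hqq : q * star q = 1 := omg_mul_star _ _
  have huu : u * star u = 1 := omg_mul_star _ _
  have hqd : q ^ d = u := by
    rw [hq, hu, omg_pow]
    congr 1
    ring
  have hXd : (q • A) ^ d = u • 1 := by rw [smul_pow, hqd, hAd]
  have hYd : (star q • B) ^ d = star u • 1 := by rw [smul_pow, ← star_pow, hqd, hBd]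
  have hX : (q • A) * (q • A)ᴴ = 1 := by
    rw [conjTranspose_smul, smul_mul_smul_comm, hqq, hA1, one_smul]
  have hY : (star q • B) * (star q • B)ᴴ = 1 := by
    rw [conjTranspose_smul, smul_mul_smul_comm, star_star, mul_comm, hqq, hB1, one_smul]
  have hsum := acoef_zero_add_star hd0 hm
  have hα := acoef_ne_zero d hm 0
  have hαu := acoef_zero_mul_omg (d := d) hm
  rw [← hu] at hαu
  set α := acoef d m 0
  have hpow : ∀ k ≤ d, α • (q • A) ^ k + star α • (star q • B) ^ k
      = (α • (q • A) + star α • (star q • B)) ^ k := by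
    have hone : abar d m A B 1 = α • (q • A) + star α • (star q • B) := by
      rw [abar_eq hm, pow_one, pow_one]
    intro k hk
    rcases Nat.eq_zero_or_pos k with rfl | hk0
    · rw [pow_zero, pow_zero, pow_zero, ← add_smul, hsum, one_smul]
    rcases hk.lt_or_eq with hk | rfl
    · rw [← hone, ← hrel2 k hk0 (by omega), abar_eq hm]
    · have h1 := hrel1 1 le_rfl (by omega)
      rw [hrel2 (k - 1) (by omega) le_rfl, ← pow_succ', Nat.sub_add_cancel hk0, hone] at h1
      rw [h1, hXd, hYd, smul_smul, smul_smul, ← add_smul, hαu, ← hαu, mul_assoc, huu, mul_one,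
        hαu, add_comm, hsum, one_smul]
  obtain ⟨E, hEH, hEE, htr, hwand, hYE⟩ := exists_wandering_projection (D := D) hd0 hsum hα
    (star_ne_zero.mpr hα) hpow huu (omg_sq_ne_one hd0 hm) hXd hYd hX hY (by simp)
  obtain ⟨W, hW1, hW2⟩ := exists_isometry_of_projection hEH hEE htr
  have hq0 : q ≠ 0 := left_ne_zero_of_mul_eq_one hqq
  refine exists_unitary_of_wandering hd0 (isPrimitiveRoot_omg_one hd0) (omg_mul_star d 1) hAd
    (mul_eq_one_comm.mp hA1) hW1 (fun j hj hjd => ?_) (p := q ^ 2) (γ := 1 - star u ^ 2) ?_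
    reflVec_mul_star ?_ (Tmat_apply hd0 hm)
  · have h1 := hwand j hj hjd
    rw [smul_pow, mul_smul_comm, smul_mul_assoc] at h1
    have h2 := (smul_eq_zero.mp h1).resolve_left (pow_ne_zero _ hq0)
    calc Wᴴ * A ^ j * W = (Wᴴ * W) * (Wᴴ * A ^ j * W) * (Wᴴ * W) := by
          rw [hW1, Matrix.one_mul, Matrix.mul_one]
      _ = Wᴴ * ((W * Wᴴ) * A ^ j * (W * Wᴴ)) * W := by simp only [Matrix.mul_assoc]
      _ = 0 := by rw [hW2, h2, Matrix.mul_zero, Matrix.zero_mul]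
  · rw [hW2]
    have h1 := congr_arg (fun M => q • M) hYE
    simp only [smul_smul, hqq, one_smul, mul_smul_comm] at h1
    rw [h1, ← pow_two q]
  · rw [Zmat]
    congr 1
    ext i
    rw [omg_pow, mul_one]
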